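/- arXiv:1007.5368 — 6 statements merged into one kernel-verified Lean document; each statement's English description precedes it below -/
import Mathlib

section
/- For every n ∈ ω and every pair (b,𝓑) ∈ H_n, pnor(b,𝓑) is well defined, i.e. the set {k ∈ ω : pnor(b,𝓑) ≥ k} is finite (bounded); moreover, for every k ∈ ω, if pnor(b,𝓑) ≥ k then 2^k ≤ |𝓑| (hence 2^{pnor(b,𝓑)} ≤ |𝓑|). -/
open Ordinal

/-- A *basic `n`-block*: a finite set `B` of functions from a nonempty finite
`v ⊆ ω` to `2` such that `|B|/2^{|v|} < 2^{-n}`. -/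
structure BasicBlock (n : ℕ) where
  v : Finset ℕ
  hv : v.Nonempty
  B : Set (↥v → Bool)
  small : B.ncard * 2 ^ n < 2 ^ v.card

/-- `η ≺ B` : the restriction of `η` to `v(B)` belongs to `B`. -/
def Prec {n : ℕ} (η : ℕ → Bool) (Bl : BasicBlock n) : Prop :=
  (fun i : ↥Bl.v => η i) ∈ Bl.B

/-- `(b, 𝓑) ∈ H_n` : `b ≥ 1` and `𝓑` is a nonempty finite set of basic `n`-blocks. -/
def MemHn (n : ℕ) (b : ℕ) (S : Set (BasicBlock n)) : Prop :=
  1 ≤ b ∧ S.Nonempty ∧ S.Finite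

/-- The relation `pnor(b,𝓑) ≥ k`, defined by recursion on `k`. -/
def PnorGe (n : ℕ) : ℕ → ℕ → Set (BasicBlock n) → Prop
  | 0, _, _ => True
  | 1, b, S => ∀ F : Finset (ℕ → Bool), F.card = b → ∃ Bl ∈ S, ∀ η ∈ F, Prec η Bl
  | k + 2, b, S => ∃ (M : ℕ) (bs : ℕ → ℕ) (Bs : ℕ → Set (BasicBlock n)),
      b ^ (k + 2) < M ∧ b ≤ bs 0 ∧
      (∀ i, i < M → 0 < bs i) ∧
      (∀ i, i + 1 < M → (bs i) ^ 2 * 2 ^ ((Bs i).ncard ^ n) < bs (i + 1)) ∧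
      (∀ i, i < M → Bs i ⊆ S) ∧
      (∀ i j, i < M → j < M → i ≠ j → Disjoint (Bs i) (Bs j)) ∧
      (∀ i, i < M → PnorGe n (k + 1) (bs i) (Bs i))

lemma exists_not_prec {n : ℕ} (Bl : BasicBlock n) : ∃ η : ℕ → Bool, ¬ Prec η Bl := by
  classical
  by_contra hcon
  push Not at hcon
  have hB : Bl.B = Set.univ := by
    ext f
    simp only [Set.mem_univ, iff_true]
    have := hcon (fun i => if h : i ∈ Bl.v then f ⟨i, h⟩ else false)
    unfold Prec at this
    convert this using 2
    rename_i x
    simp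
  have hs := Bl.small
  rw [hB, Set.ncard_univ, Nat.card_eq_fintype_card] at hs
  simp only [Fintype.card_fun, Fintype.card_bool, Fintype.card_coe] at hs
  have : 1 ≤ 2 ^ n := Nat.one_le_two_pow
  nlinarith [Nat.zero_le (2 ^ Bl.v.card)]

lemma pnor_bound (n : ℕ) : ∀ (k b : ℕ) (S : Set (BasicBlock n)), 1 ≤ b → S.Finite →
    PnorGe n (k + 1) b S → 2 ^ (k + 1) ≤ S.ncard := by
  intro k
  induction k with
  | zero =>
    intro b S hb hS hp
    simp only [zero_add, PnorGe] at hp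
    by_contra hlt
    have h1 : S.ncard ≤ 1 := by simp at hlt; omega
    have hη : ∃ η : ℕ → Bool, ∀ Bl ∈ S, ¬ Prec η Bl := by
      rcases S.eq_empty_or_nonempty with rfl | ⟨B0, h0⟩
      · exact ⟨fun _ => false, by simp⟩
      · obtain ⟨η, hη⟩ := exists_not_prec B0
        refine ⟨η, fun Bl hBl => ?_⟩
        rw [(Set.ncard_le_one hS).1 h1 Bl hBl B0 h0]
        exact hη
    obtain ⟨η, hη⟩ := hη
    obtain ⟨F, hF, hc⟩ := Infinite.exists_superset_card_eq ({η} : Finset (ℕ → Bool)) b (by simpa)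
    obtain ⟨Bl, hBl, hall⟩ := hp F hc
    exact hη Bl hBl (hall η (hF (by simp)))
  | succ k ih =>
    intro b S hb hS hp
    obtain ⟨M, bs, Bs, hM, -, hpos, -, hsub, hdisj, hrec⟩ := hp
    have hM2 : 1 < M := lt_of_le_of_lt (Nat.one_le_pow _ _ hb) hM
    have hf0 := hS.subset (hsub 0 (by omega))
    have hf1 := hS.subset (hsub 1 hM2)
    have h0 := ih (bs 0) (Bs 0) (hpos 0 (by omega)) hf0 (hrec 0 (by omega))
    have h1 := ih (bs 1) (Bs 1) (hpos 1 hM2) hf1 (hrec 1 hM2)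
    have hu := Set.ncard_union_eq (hdisj 0 1 (by omega) hM2 (by omega)) hf0 hf1
    have hle := Set.ncard_le_ncard (Set.union_subset (hsub 0 (by omega)) (hsub 1 hM2)) hS
    rw [pow_succ]
    omega

/-- for `(b,𝓑) ∈ H_n` the set `{k : pnor(b,𝓑) ≥ k}` is bounded
(so `pnor(b,𝓑)` is well defined), and `pnor(b,𝓑) ≥ k` implies `2^k ≤ |𝓑|`. -/
theorem pnor_well_defined_and_bound (n b : ℕ) (S : Set (BasicBlock n))
    (h : MemHn n b S) :
    (∃ m : ℕ, ∀ k : ℕ, PnorGe n k b S → k ≤ m) ∧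
    (∀ k : ℕ, PnorGe n k b S → 2 ^ k ≤ S.ncard) := by
  obtain ⟨hb, hne, hfin⟩ := h
  have key : ∀ k : ℕ, PnorGe n k b S → 2 ^ k ≤ S.ncard := by
    intro k hk
    cases k with
    | zero => exact (Set.ncard_pos hfin).2 hne
    | succ k => exact pnor_bound n k b S hb hfin hk
  exact ⟨⟨S.ncard, fun k hk => (Nat.lt_two_pow_self.le).trans (key k hk)⟩, key⟩
end

section
/- For every n ∈ ω and every N ∈ ω there is a pair (b*,𝓑*) ∈ H_n such that b* ≥ N, pnor(b*,𝓑*) ≥ N, and min(v(B)) > N for every B ∈ 𝓑*. -/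
open Ordinal

theorem pnor_base (n b L : ℕ) (hb : 1 ≤ b) :
    ∃ (S : Set (BasicBlock n)) (U : ℕ), S.Nonempty ∧ S.Finite ∧ PnorGe n 1 b S ∧ L ≤ U ∧
      ∀ Bl ∈ S, ∀ x ∈ Bl.v, L < x ∧ x ≤ U := by
  classical
  have hcard : (Finset.Ioc L (L + (b + n))).card = b + n := by simp
  have hne : (Finset.Ioc L (L + (b + n))).Nonempty := by
    rw [← Finset.card_pos, hcard]; omega
  generalize hv0 : Finset.Ioc L (L + (b + n)) = v0 at hcard hne
  refine ⟨{Bl | Bl.v = v0}, L + (b + n), ⟨⟨v0, hne, ∅, by simp⟩, rfl⟩, ?_, ?_, by omega, ?_⟩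
  · have : {Bl : BasicBlock n | Bl.v = v0} ⊆
        Set.range (fun B : {B : Set (↥v0 → Bool) // B.ncard * 2 ^ n < 2 ^ v0.card} =>
          (⟨v0, hne, B.1, B.2⟩ : BasicBlock n)) := by
      rintro ⟨v, hv, B, hs⟩ h
      change v = v0 at h
      subst h
      exact ⟨⟨B, hs⟩, rfl⟩
    exact (Set.finite_range _).subset this
  · intro F hF
    refine ⟨⟨v0, hne, (fun (η : ℕ → Bool) (i : ↥v0) => η i) '' (F : Set (ℕ → Bool)), ?_⟩, rfl, ?_⟩
    · have h1 : ((fun (η : ℕ → Bool) (i : ↥v0) => η i) '' (F : Set (ℕ → Bool))).ncard ≤ b := by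
        refine (Set.ncard_image_le F.finite_toSet).trans ?_
        rw [Set.ncard_coe_finset, hF]
      rw [hcard, pow_add]
      exact Nat.mul_lt_mul_of_pos_right (h1.trans_lt Nat.lt_two_pow_self) (by positivity)
    · intro η hη
      exact ⟨η, hη, rfl⟩
  · rintro Bl h x hx
    change Bl.v = v0 at h
    rw [h, ← hv0, Finset.mem_Ioc] at hx
    exact hx

theorem pnor_step (n k : ℕ) : ∀ b L : ℕ,
    ∃ (S : Set (BasicBlock n)) (U : ℕ), 1 ≤ b → S.Nonempty ∧ S.Finite ∧ PnorGe n (k + 1) b S ∧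
      L ≤ U ∧ ∀ Bl ∈ S, ∀ x ∈ Bl.v, L < x ∧ x ≤ U := by
  induction k with
  | zero =>
    intro b L
    by_cases hb : 1 ≤ b
    · obtain ⟨S, U, h⟩ := pnor_base n b L hb
      exact ⟨S, U, fun _ => h⟩
    · exact ⟨∅, 0, fun h => absurd h hb⟩
  | succ k ih =>
    intro b L
    choose f g h using ih
    let st : ℕ × ℕ → ℕ × ℕ := fun p => (p.1 ^ 2 * 2 ^ ((f p.1 p.2).ncard ^ n) + 1, g p.1 p.2)
    let q : ℕ → ℕ × ℕ := fun i => st^[i] (b, L)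
    have q0 : q 0 = (b, L) := rfl
    have qs : ∀ i, q (i + 1) = st (q i) := fun i => Function.iterate_succ_apply' st i _
    let T : ℕ → Set (BasicBlock n) := fun i => f (q i).1 (q i).2
    let M := b ^ (k + 2) + 1
    by_cases hb : 1 ≤ b
    swap
    · exact ⟨∅, 0, fun h => absurd h hb⟩
    have hq : ∀ i, 1 ≤ (q i).1 := by
      intro i
      cases i with
      | zero => exact hb
      | succ i => rw [qs]; exact Nat.le_add_left _ _
    have hT := fun i => h (q i).1 (q i).2 (hq i)
    have hU : ∀ i, (q (i + 1)).2 = g (q i).1 (q i).2 := fun i => by rw [qs]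
    have hmono : Monotone (fun i => (q i).2) := by
      refine monotone_nat_of_le_succ fun i => ?_
      change (q i).2 ≤ (q (i + 1)).2
      rw [hU]
      exact (hT i).2.2.2.1
    have hdis : ∀ i j, i < j → Disjoint (T i) (T j) := by
      intro i j hij
      rw [Set.disjoint_left]
      intro Bl h1 h2
      obtain ⟨x, hx⟩ := Bl.hv
      have a1 := ((hT i).2.2.2.2 Bl h1 x hx).2
      have a2 := ((hT j).2.2.2.2 Bl h2 x hx).1
      have a3 : (q (i + 1)).2 ≤ (q j).2 := hmono (Nat.succ_le_of_lt hij)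
      rw [hU] at a3
      omega
    refine ⟨⋃ i ∈ Set.Iio M, T i, (q M).2, fun _ => ⟨?_, ?_, ?_, ?_, ?_⟩⟩
    · obtain ⟨Bl, hBl⟩ := (hT 0).1
      exact ⟨Bl, Set.mem_biUnion (Set.mem_Iio.2 (Nat.succ_pos _)) hBl⟩
    · exact (Set.finite_Iio M).biUnion fun i _ => (hT i).2.1
    · refine ⟨M, fun i => (q i).1, T, Nat.lt_succ_self _, le_refl b, fun i _ => hq i, ?_, ?_, ?_,
        fun i _ => (hT i).2.2.1⟩
      · intro i _
        change _ < (q (i + 1)).1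
        rw [qs]
        exact Nat.lt_succ_self _
      · intro i hi
        exact Set.subset_biUnion_of_mem (u := T) (Set.mem_Iio.2 hi)
      · intro i j _ _ hij
        rcases lt_or_gt_of_ne hij with hl | hl
        · exact hdis i j hl
        · exact (hdis j i hl).symm
    · exact hmono (Nat.zero_le M)
    · intro Bl hBl x hx
      obtain ⟨i, hi, hBi⟩ := Set.mem_iUnion₂.1 hBl
      have a := (hT i).2.2.2.2 Bl hBi x hx
      have a0 : L ≤ (q i).2 := hmono (Nat.zero_le i)
      have a3 : (q (i + 1)).2 ≤ (q M).2 := hmono (Nat.succ_le_of_lt hi)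
      rw [hU] at a3
      omega

/-- for every `n` and `N` there is `(b*,𝓑*) ∈ H_n` with `b* ≥ N`,
`pnor(b*,𝓑*) ≥ N` and `min(v(B)) > N` for all `B ∈ 𝓑*`. -/
theorem pnor_large_pairs_exist (n N : ℕ) :
    ∃ (b : ℕ) (S : Set (BasicBlock n)), MemHn n b S ∧ N ≤ b ∧
      PnorGe n N b S ∧ ∀ Bl ∈ S, N < Bl.v.min' Bl.hv := by
  obtain ⟨S, U, h⟩ := pnor_step n (N - 1) (N + 1) N
  obtain ⟨h1, h2, h3, -, h4⟩ := h (by omega)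
  refine ⟨N + 1, S, ⟨by omega, h1, h2⟩, by omega, ?_, ?_⟩
  · cases N with
    | zero => exact trivial
    | succ k => exact h3
  · intro Bl hBl
    exact (h4 Bl hBl _ (Finset.min'_mem _ _)).1
end

section
/- Let n ∈ ω, (b,𝓑) ∈ H_n and k ≥ 1 with pnor(b,𝓑) ≥ k+1. Then for every coloring c : 𝓑 → {0,…,b−1} there exists ℓ < b such that pnor(b, c⁻¹[{ℓ}]) ≥ k. -/
open Ordinal

theorem pnor_nonempty (n : ℕ) : ∀ (k b : ℕ) (S : Set (BasicBlock n)),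
    PnorGe n (k + 1) b S → S.Nonempty := by
  intro k
  induction k with
  | zero =>
    intro b S h
    obtain ⟨F, hF⟩ := Infinite.exists_subset_card_eq (ℕ → Bool) b
    obtain ⟨B, hB, -⟩ := h F hF
    exact ⟨B, hB⟩
  | succ k ih =>
    intro b S h
    obtain ⟨M, bs, Bs, hM, -, -, -, hsub, -, hp⟩ := h
    have hM0 : 0 < M := by omega
    exact (ih _ _ (hp 0 hM0)).mono (hsub 0 hM0)

theorem pnor_coloring_aux (n : ℕ) : ∀ (k b : ℕ) (S : Set (BasicBlock n)), 1 ≤ b → S.Finite →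
    PnorGe n (k + 2) b S → ∀ c : BasicBlock n → ℕ, (∀ Bl ∈ S, c Bl < b) →
    ∃ ℓ < b, PnorGe n (k + 1) b (S ∩ c ⁻¹' {ℓ}) := by
  classical
  intro k
  induction k with
  | zero =>
    intro b S hb _ h c hc
    obtain ⟨M, bs, Bs, hM, hb0, hpos, hgrow, hsub, -, hp⟩ := h
    by_contra hcon
    push Not at hcon
    have hbad : ∀ ℓ, ∃ F : Finset (ℕ → Bool), ℓ < b → F.card = b ∧
        ∀ Bl ∈ S ∩ c ⁻¹' {ℓ}, ¬ ∀ η ∈ F, Prec η Bl := by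
      intro ℓ
      by_cases hl : ℓ < b
      · have h1 := hcon ℓ hl
        simp only [PnorGe] at h1
        push Not at h1
        obtain ⟨F, hF, hF2⟩ := h1
        refine ⟨F, fun _ => ⟨hF, fun Bl hBl hall => ?_⟩⟩
        obtain ⟨η, h1, h2⟩ := hF2 Bl hBl
        exact h2 (hall η h1)
      · exact ⟨∅, fun h => absurd h hl⟩
    choose F hF using hbad
    have hM1 : 0 + 1 < M := by
      have : 1 ≤ b ^ (0 + 2) := Nat.one_le_pow _ _ hb
      exact lt_of_le_of_lt this hM
    have hcard : ((Finset.range b).biUnion F).card ≤ bs 1 := by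
      have h1 : ((Finset.range b).biUnion F).card ≤ b * b := by
        have := Finset.card_biUnion_le_card_mul (Finset.range b) F b
          (fun ℓ hl => ((hF ℓ (Finset.mem_range.1 hl)).1).le)
        simpa using this
      have h2 := hgrow 0 hM1
      have h3 : b * b ≤ bs 0 ^ 2 := by nlinarith
      have h4 : bs 0 ^ 2 ≤ bs 0 ^ 2 * 2 ^ ((Bs 0).ncard ^ n) :=
        Nat.le_mul_of_pos_right _ (by positivity)
      simp only [zero_add] at h2
      omega
    obtain ⟨G, hG, hGc⟩ := Infinite.exists_superset_card_eq _ _ hcard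
    obtain ⟨B, hB, hBall⟩ := hp 1 hM1 G hGc
    have hBS := hsub 1 hM1 hB
    have hl := hc B hBS
    refine (hF (c B) hl).2 B ⟨hBS, rfl⟩ fun η hη => hBall η (hG ?_)
    exact Finset.mem_biUnion.2 ⟨c B, Finset.mem_range.2 hl, hη⟩
  | succ k ih =>
    intro b S hb hfin h c hc
    obtain ⟨M, bs, Bs, hM, hb0, hpos, hgrow, hsub, hdis, hp⟩ := h
    have hstep : ∀ i, i + 1 < M → bs i < bs (i + 1) := by
      intro i hi
      have h1 := hgrow i hi
      have h2 := hpos i (by omega)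
      have h4 : bs i ^ 2 ≤ bs i ^ 2 * 2 ^ ((Bs i).ncard ^ n) :=
        Nat.le_mul_of_pos_right _ (by positivity)
      nlinarith
    have hmono : ∀ d i, i + d < M → bs i ≤ bs (i + d) := by
      intro d
      induction d with
      | zero => intro i _; simp
      | succ d ihd =>
        intro i hi
        exact (ihd i (by omega)).trans (hstep (i + d) (by omega)).le
    have hge : ∀ i, i < M → b ≤ bs i := fun i hi => by
      have := hmono i 0 (by omega)
      rw [zero_add] at this
      exact hb0.trans this
    have hcol : ∀ i, ∃ ℓ, i < M → ℓ < b ∧ PnorGe n (k + 1) (bs i) (Bs i ∩ c ⁻¹' {ℓ}) := by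
      intro i
      by_cases hi : i < M
      · obtain ⟨ℓ, -, hl⟩ := ih (bs i) (Bs i) (hpos i hi) (hfin.subset (hsub i hi)) (hp i hi) c
          (fun B hB => (hc B (hsub i hi hB)).trans_le (hge i hi))
        obtain ⟨B, hB, hBl⟩ := pnor_nonempty n k _ _ hl
        have hBl : c B = ℓ := hBl
        exact ⟨ℓ, fun _ => ⟨hBl ▸ hc B (hsub i hi hB), hl⟩⟩
      · exact ⟨0, fun h => absurd h hi⟩
    choose l hl using hcol
    obtain ⟨ℓ, hlb, hcard⟩ := Finset.exists_lt_card_fiber_of_mul_lt_card_of_maps_to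
      (s := Finset.range M) (t := Finset.range b) (f := l) (n := b ^ (k + 2))
      (fun i hi => Finset.mem_coe.2 (Finset.mem_range.2 (hl i (Finset.mem_range.1 hi)).1))
      (by
        simp only [Finset.card_range]
        calc b * b ^ (k + 2) = b ^ (k + 1 + 2) := by ring
          _ < M := hM)
    set A := (Finset.range M).filter (fun i => l i = ℓ) with hA
    have hmemA : ∀ i, i ∈ A → i < M ∧ l i = ℓ := fun i hi => by simpa [hA] using hi
    have hAf : ({i | i ∈ A} : Set ℕ).Finite := A.finite_toSet
    have hAc : hAf.toFinset.card = A.card := by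
      congr 1; ext; simp
    set e := Nat.nth (fun i => i ∈ A) with he
    have hemem : ∀ j, j < A.card → e j < M ∧ l (e j) = ℓ := fun j hj =>
      hmemA _ (Nat.nth_mem_of_lt_card hAf (by rwa [hAc]))
    have helt : ∀ i j, i < j → j < A.card → e i < e j := fun i j hij hj =>
      Nat.nth_lt_nth_of_lt_card hAf hij (by rwa [hAc])
    refine ⟨ℓ, Finset.mem_range.1 hlb, A.card, fun j => bs (e j),
      fun j => Bs (e j) ∩ c ⁻¹' {ℓ}, hcard, ?_, ?_, ?_, ?_, ?_, ?_⟩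
    · exact hge _ (hemem 0 (by omega)).1
    · exact fun i hi => hpos _ (hemem i hi).1
    · intro i hi
      have h1 := helt i (i + 1) (by omega) hi
      have h2 := (hemem (i + 1) hi).1
      have h3 := hmono (e (i + 1) - (e i + 1)) (e i + 1) (by omega)
      rw [show e i + 1 + (e (i + 1) - (e i + 1)) = e (i + 1) by omega] at h3
      refine lt_of_le_of_lt ?_ ((hgrow (e i) (by omega)).trans_le h3)
      have h5 : (Bs (e i) ∩ c ⁻¹' {ℓ}).ncard ≤ (Bs (e i)).ncard :=
        Set.ncard_le_ncard Set.inter_subset_left (hfin.subset (hsub _ (by omega)))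
      exact Nat.mul_le_mul_left _ (Nat.pow_le_pow_right (by norm_num) (Nat.pow_le_pow_left h5 n))
    · exact fun i hi => Set.inter_subset_inter_left _ (hsub _ (hemem i hi).1)
    · intro i j hi hj hij
      refine (hdis _ _ (hemem i hi).1 (hemem j hj).1 ?_).mono Set.inter_subset_left
        Set.inter_subset_left
      rcases lt_or_gt_of_ne hij with h | h
      · exact (helt _ _ h hj).ne
      · exact (helt _ _ h hi).ne'
    · intro i hi
      have h1 := hemem i hi
      have h2 := (hl (e i) h1.1).2
      rwa [h1.2] at h2

/-- if `(b,𝓑) ∈ H_n`, `k ≥ 1` and `pnor(b,𝓑) ≥ k+1`, then for every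
coloring `c : 𝓑 → {0,…,b-1}` there is `ℓ < b` with `pnor(b, c⁻¹[{ℓ}]) ≥ k`. -/
theorem pnor_coloring (n b k : ℕ) (S : Set (BasicBlock n)) (h : MemHn n b S)
    (hk : 1 ≤ k) (hpnor : PnorGe n (k + 1) b S)
    (c : BasicBlock n → ℕ) (hc : ∀ Bl ∈ S, c Bl < b) :
    ∃ ℓ < b, PnorGe n k b (S ∩ c ⁻¹' {ℓ}) := by
  obtain ⟨hb, -, hfin⟩ := h
  obtain ⟨k, rfl⟩ : ∃ m, k = m + 1 := ⟨k - 1, by omega⟩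
  exact pnor_coloring_aux n k b S hb hfin hpnor c hc
end

section
/- Suppose the σ-ideal I on the Cantor space 2^ω has an mhg-base 𝓑 ⊆ Borel(2^ω) ∩ I. Then there exists a monotone Borel hull operation ψ : I → Borel(2^ω) ∩ I on I; moreover ψ can be chosen so that for every A ∈ I, ψ(A) is the intersection of countably many members of 𝓑. -/
open Ordinal

/-- if a σ-ideal `I` on the Cantor space `2^ω` has an mhg-base
`𝓑 ⊆ Borel(2^ω) ∩ I`, then there is a monotone Borel hull operation
`ψ : I → Borel(2^ω) ∩ I` on `I`; moreover `ψ` can be chosen so that each `ψ(A)`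
is an intersection of countably many members of `𝓑`. -/
theorem monotone_borel_hull_of_mhg_base
    (I : Set (Set (ℕ → Bool)))
    (hIne : I.Nonempty)
    (hIdown : ∀ A B : Set (ℕ → Bool), A ⊆ B → B ∈ I → A ∈ I)
    (hIunion : ∀ f : ℕ → Set (ℕ → Bool), (∀ k, f k ∈ I) → (⋃ k, f k) ∈ I)
    (𝓑 : Set (Set (ℕ → Bool)))
    (hBorel : ∀ B ∈ 𝓑, MeasurableSet B)
    (hBI : 𝓑 ⊆ I)
    (hbasis : ∀ A ∈ I, ∃ B ∈ 𝓑, A ⊆ B)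
    (hmhg : ∀ f : Ordinal → Set (ℕ → Bool), (∀ i, i < ω₁ → f i ∈ 𝓑) →
      ∃ i j, i < j ∧ j < ω₁ ∧ f i ⊆ f j) :
    ∃ ψ : Set (ℕ → Bool) → Set (ℕ → Bool),
      (∀ A ∈ I, A ⊆ ψ A ∧ ψ A ∈ I ∧ MeasurableSet (ψ A)) ∧
      (∀ A₁ A₂, A₁ ∈ I → A₂ ∈ I → A₁ ⊆ A₂ → ψ A₁ ⊆ ψ A₂) ∧
      (∀ A ∈ I, ∃ g : ℕ → Set (ℕ → Bool), (∀ k, g k ∈ 𝓑) ∧ ψ A = ⋂ k, g k) := by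
  classical
  have key : ∀ F : Set (Set (ℕ → Bool)), F ⊆ 𝓑 →
      ∃ C : Set (Set (ℕ → Bool)), C.Countable ∧ C ⊆ F ∧ ∀ B ∈ F, ⋂₀ C ⊆ B := by
    intro F hF
    by_contra hcon
    push Not at hcon
    choose! G hG using hcon
    let f : Ordinal → Set (ℕ → Bool) :=
      WellFounded.fix (C := fun _ => Set (ℕ → Bool)) (wellFounded_lt (α := Ordinal))
        (fun i rec => G (Set.range (fun j : Set.Iio i => rec j.1 j.2)))
    have hf : ∀ i, f i = G (Set.range (fun j : Set.Iio i => f j.1)) := by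
      intro i
      exact WellFounded.fix_eq _ _ _
    have hc : ∀ i, i < ω₁ → (Set.range (fun j : Set.Iio i => f j.1)).Countable := by
      intro i hi
      have : Countable (Set.Iio i) := by
        rw [← Cardinal.mk_le_aleph0_iff, Cardinal.mk_Iio_ordinal, Cardinal.lift_le_aleph0]
        rw [Cardinal.lt_omega_iff_card_lt, ← Cardinal.succ_aleph0] at hi
        exact Order.lt_succ_iff.1 hi
      exact Set.countable_range _
    have hmem : ∀ i, i < ω₁ → f i ∈ F := by
      intro i
      induction i using WellFoundedLT.induction with
      | ind i ih =>
        intro hi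
        rw [hf]
        refine (hG _ (hc i hi) ?_).1
        rintro _ ⟨j, rfl⟩
        exact ih j.1 j.2 (lt_trans j.2 hi)
    obtain ⟨i, j, hij, hj, hsub⟩ := hmhg f (fun i hi => hF (hmem i hi))
    have h := (hG _ (hc j hj) (by
      rintro _ ⟨k, rfl⟩
      exact hmem k.1 (lt_trans k.2 hj))).2
    rw [← hf] at h
    have hi : f i ∈ Set.range (fun k : Set.Iio j => f k.1) := ⟨⟨i, hij⟩, rfl⟩
    exact h ((Set.sInter_subset_of_mem hi).trans hsub)
  have hrep : ∀ A ∈ I, ∃ g : ℕ → Set (ℕ → Bool),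
      (∀ k, g k ∈ 𝓑) ∧ ⋂₀ {B | B ∈ 𝓑 ∧ A ⊆ B} = ⋂ k, g k := by
    intro A hA
    obtain ⟨C, hC, hCF, hCB⟩ := key {B | B ∈ 𝓑 ∧ A ⊆ B} (fun B hB => hB.1)
    obtain ⟨B₀, hB₀, hAB₀⟩ := hbasis A hA
    obtain ⟨g, hg⟩ := (hC.insert B₀).exists_eq_range (Set.insert_nonempty _ _)
    have hgF : ∀ k, g k ∈ 𝓑 ∧ A ⊆ g k := by
      intro k
      have hk : g k ∈ insert B₀ C := hg ▸ Set.mem_range_self k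
      rcases hk with hk | hk
      · rw [hk]; exact ⟨hB₀, hAB₀⟩
      · exact hCF hk
    refine ⟨g, fun k => (hgF k).1, Set.Subset.antisymm ?_ ?_⟩
    · exact Set.subset_iInter fun k => Set.sInter_subset_of_mem (hgF k)
    · refine Set.subset_sInter fun B hB => Set.Subset.trans ?_ (hCB B hB)
      rw [← Set.sInter_range, ← hg]
      exact Set.sInter_subset_sInter (Set.subset_insert _ _)
  refine ⟨fun A => ⋂₀ {B | B ∈ 𝓑 ∧ A ⊆ B}, ?_, ?_, hrep⟩
  · intro A hA
    refine ⟨Set.subset_sInter fun B hB => hB.2, ?_, ?_⟩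
    · obtain ⟨B₀, hB₀, hAB₀⟩ := hbasis A hA
      exact hIdown _ B₀ (Set.sInter_subset_of_mem ⟨hB₀, hAB₀⟩) (hBI hB₀)
    · obtain ⟨g, hg, he⟩ := hrep A hA
      simp only [he]
      exact MeasurableSet.iInter fun k => hBorel _ (hg k)
  · intro A₁ A₂ _ _ h
    exact Set.sInter_subset_sInter fun B hB => ⟨hB.1, h.trans hB.2⟩
end

section
/- Let X be a set and let 𝓑 be a family of subsets of X such that for every sequence ⟨B_i : i < ω₁⟩ of elements of 𝓑 there are i < j < ω₁ with B_i ⊆ B_j. Then for every A ⊆ X such that {B ∈ 𝓑 : A ⊆ B} is nonempty, there exists a countable subfamily 𝓑' ⊆ {B ∈ 𝓑 : A ⊆ B} with ⋂𝓑' = ⋂{B ∈ 𝓑 : A ⊆ B}. -/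
open Ordinal

lemma countable_Iio_aux {i : Ordinal} (hi : i < ω₁) : (Set.Iio i).Countable := by
  rw [← Cardinal.le_aleph0_iff_set_countable, Cardinal.mk_Iio_ordinal, Cardinal.lift_le_aleph0]
  rw [← Cardinal.ord_aleph, Cardinal.lt_ord, ← Cardinal.succ_aleph0, Order.lt_succ_iff] at hi
  exact hi

/-- if every `ω₁`-sequence from `𝓑` contains `i < j` with
`B_i ⊆ B_j`, then for every `A` with `{B ∈ 𝓑 : A ⊆ B}` nonempty there is a
countable subfamily of `{B ∈ 𝓑 : A ⊆ B}` with the same intersection. -/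
theorem countable_subfamily_same_inter {X : Type*} (𝓑 : Set (Set X))
    (hmhg : ∀ f : Ordinal → Set X, (∀ i, i < ω₁ → f i ∈ 𝓑) →
      ∃ i j, i < j ∧ j < ω₁ ∧ f i ⊆ f j)
    (A : Set X) (hA : {B | B ∈ 𝓑 ∧ A ⊆ B}.Nonempty) :
    ∃ 𝓑' ⊆ {B | B ∈ 𝓑 ∧ A ⊆ B}, 𝓑'.Countable ∧
      ⋂₀ 𝓑' = ⋂₀ {B | B ∈ 𝓑 ∧ A ⊆ B} := by
  by_contra hcon
  have key : ∀ S : Set (Set X), ∃ B, S ⊆ {B | B ∈ 𝓑 ∧ A ⊆ B} → S.Countable →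
      B ∈ {B | B ∈ 𝓑 ∧ A ⊆ B} ∧ ¬ ⋂₀ S ⊆ B := by
    intro S
    by_contra h
    push Not at h
    obtain ⟨hS, hc, _⟩ := h ∅
    refine hcon ⟨S, hS, hc, subset_antisymm ?_ (Set.sInter_subset_sInter hS)⟩
    exact Set.subset_sInter fun B hB => (h B).2.2 hB
  choose g hg using key
  let f : Ordinal → Set X := (wellFounded_lt (α := Ordinal)).fix
    (fun i ih => g {B | ∃ j, ∃ h : j < i, ih j h = B})
  have hf : ∀ i, f i = g (f '' Set.Iio i) := by
    intro i
    have h1 := (wellFounded_lt (α := Ordinal)).fix_eq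
      (fun i ih => g {B | ∃ j, ∃ h : j < i, ih j h = B}) i
    refine h1.trans ?_
    congr 1
    ext B
    simp [f]
  have hmem : ∀ i, i < ω₁ → f i ∈ {B | B ∈ 𝓑 ∧ A ⊆ B} := by
    intro i
    induction i using WellFoundedLT.induction with
    | ind i ih =>
      intro hi
      rw [hf]
      refine (hg _ ?_ ((countable_Iio_aux hi).image f)).1
      rintro _ ⟨j, hj, rfl⟩
      exact ih j hj (lt_trans hj hi)
  obtain ⟨i, j, hij, hj, hsub⟩ := hmhg f fun i hi => (hmem i hi).1
  have h2 := (hg (f '' Set.Iio j) (by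
    rintro _ ⟨k, hk, rfl⟩
    exact hmem k (lt_trans hk hj)) ((countable_Iio_aux hj).image f)).2
  rw [← hf] at h2
  have h3 : f i ∈ f '' Set.Iio j := ⟨i, hij, rfl⟩
  exact h2 ((Set.sInter_subset_of_mem h3).trans hsub)
end

section
/- Let F be a closed subset of the Cantor space 2^ω with μ(F) > 0, and let F* = {x ∈ 2^ω : for every y ∈ F, x(n) ≠ y(n) for infinitely many n}. Then F* is a G_δ subset of 2^ω and μ(F*) = 0. -/
open MeasureTheory

/-- The coordinates are independent under `μ`. -/
theorem coord_indep (μ : Measure (ℕ → Bool))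
    (hμ : ∀ s : Finset ℕ, ∀ f : ℕ → Bool,
      μ {x : ℕ → Bool | ∀ i ∈ s, x i = f i} = (2 : ENNReal)⁻¹ ^ s.card) :
    ProbabilityTheory.iIndepFun (fun (i : ℕ) (x : ℕ → Bool) => x i) μ := by
  classical
  rw [ProbabilityTheory.iIndepFun_iff_measure_inter_preimage_eq_mul]
  intro S t _
  have huniv : μ Set.univ = 1 := by
    have := hμ ∅ (fun _ => true)
    simpa using this
  by_cases hemp : ∃ i ∈ S, t i = ∅
  · obtain ⟨i, hi, hti⟩ := hemp
    rw [Finset.prod_eq_zero hi (by simp [hti])]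
    refine measure_mono_null (Set.biInter_subset_of_mem hi) (by simp [hti])
  push Not at hemp
  have hne : ∀ i, ∃ b, i ∈ S → b ∈ t i := by
    intro i
    by_cases hi : i ∈ S
    · obtain ⟨b, hb⟩ := hemp i hi
      exact ⟨b, fun _ => hb⟩
    · exact ⟨true, fun h => absurd h hi⟩
  choose f hf using hne
  have hsing : ∀ i ∈ S, t i ≠ Set.univ → t i = {f i} := by
    intro i hi hu
    ext b
    constructor
    · intro hb
      by_contra hbf
      apply hu
      ext c
      simp only [Set.mem_univ, iff_true]
      have hfi := hf i hi
      simp only [Set.mem_singleton_iff] at hbf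
      by_cases hc : c = b
      · exact hc ▸ hb
      · have : c = f i := by
          cases hfb : f i <;> cases b <;> cases c <;> simp_all
        exact this ▸ hfi
    · rintro rfl
      exact hf i hi
  have hset : (⋂ i ∈ S, (fun x : ℕ → Bool => x i) ⁻¹' t i)
      = {x | ∀ i ∈ S.filter (fun i => t i ≠ Set.univ), x i = f i} := by
    ext x
    simp only [Set.mem_iInter, Set.mem_preimage, Finset.mem_filter, Set.mem_ofPred_eq]
    constructor
    · rintro h i ⟨hi, hu⟩
      have := h i hi
      rw [hsing i hi hu] at this
      exact this
    · intro h i hi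
      by_cases hu : t i = Set.univ
      · simp [hu]
      · rw [hsing i hi hu]
        exact h i ⟨hi, hu⟩
  rw [hset, hμ]
  have hfac : ∀ i ∈ S, μ ((fun x : ℕ → Bool => x i) ⁻¹' t i)
      = if t i ≠ Set.univ then (2 : ENNReal)⁻¹ else 1 := by
    intro i hi
    by_cases hu : t i = Set.univ
    · rw [hu, Set.preimage_univ, huniv, if_neg (by simp)]
    · rw [if_pos hu, hsing i hi hu]
      have := hμ {i} f
      simp only [Finset.mem_singleton, forall_eq, Finset.card_singleton, pow_one] at this
      exact this
  rw [Finset.prod_congr rfl hfac, ← Finset.prod_filter, Finset.prod_const]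

/-- if `F ⊆ 2^ω` is closed with `μ(F) > 0`, then
`F* = {x : ∀ y ∈ F, x(n) ≠ y(n) for infinitely many n}` is a `G_δ` set of
measure zero.  Here the product measure `μ` is characterized by its values on
cylinders. -/
theorem Gdelta_null_of_closed_positive
    (μ : Measure (ℕ → Bool))
    (hμ : ∀ s : Finset ℕ, ∀ f : ℕ → Bool,
      μ {x : ℕ → Bool | ∀ i ∈ s, x i = f i} = (2 : ENNReal)⁻¹ ^ s.card)
    (F : Set (ℕ → Bool)) (hF : IsClosed F) (hpos : 0 < μ F) :
    IsGδ {x : ℕ → Bool | ∀ y ∈ F, {n : ℕ | x n ≠ y n}.Infinite} ∧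
    μ {x : ℕ → Bool | ∀ y ∈ F, {n : ℕ | x n ≠ y n}.Infinite} = 0 := by
  have huniv : μ Set.univ = 1 := by
    have := hμ ∅ (fun _ => true)
    simpa using this
  have : IsProbabilityMeasure μ := ⟨huniv⟩
  let tail : ℕ → (ℕ → Bool) → (ℕ → Bool) := fun n x i => x (i + n)
  have htc : ∀ n, Continuous (tail n) := fun n => by
    apply continuous_pi
    intro i
    exact continuous_apply _
  have hcl : ∀ n, IsClosed (tail n '' F) := fun n => (hF.isCompact.image (htc n)).isClosed
  have hmono : ∀ m n x, m ≤ n → x ∈ tail m ⁻¹' (tail m '' F) → x ∈ tail n ⁻¹' (tail n '' F) := by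
    rintro m n x hmn ⟨y, hy, hxy⟩
    refine ⟨y, hy, ?_⟩
    funext i
    have := congrFun hxy (i + (n - m))
    simp only [tail] at this ⊢
    rwa [show i + (n - m) + m = i + n by omega] at this
  have hEq : ∀ m, {x : ℕ → Bool | ∀ y ∈ F, {n : ℕ | x n ≠ y n}.Infinite}ᶜ
      = ⋃ n, tail (n + m) ⁻¹' (tail (n + m) '' F) := by
    intro m
    ext x
    simp only [Set.mem_compl_iff, Set.mem_ofPred_eq, not_forall, Set.not_infinite, Set.mem_iUnion]
    constructor
    · rintro ⟨y, hy, hfin⟩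
      obtain ⟨N, hN⟩ := hfin.bddAbove
      refine ⟨N + 1, y, hy, ?_⟩
      funext i
      by_contra hne
      have : i + (N + 1 + m) ≤ N := hN (show x _ ≠ y _ from fun h => hne h.symm)
      omega
    · rintro ⟨n, y, hy, hxy⟩
      refine ⟨y, hy, (Set.finite_lt_nat (n + m)).subset ?_⟩
      intro k hk
      by_contra hlt
      have hle : n + m ≤ k := not_lt.mp hlt
      have := congrFun hxy (k - (n + m))
      simp only [tail, Nat.sub_add_cancel hle] at this
      exact hk this.symm
  constructor
  · rw [← compl_compl {x : ℕ → Bool | ∀ y ∈ F, {n : ℕ | x n ≠ y n}.Infinite}, hEq 0,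
      Set.compl_iUnion]
    exact IsGδ.iInter_of_isOpen fun n => ((hcl _).preimage (htc _)).isOpen_compl
  · have hind := coord_indep μ hμ
    have htail : MeasurableSet[Filter.limsup
        (fun i : ℕ => MeasurableSpace.comap (fun x : ℕ → Bool => x i) inferInstance) Filter.atTop]
        {x : ℕ → Bool | ∀ y ∈ F, {n : ℕ | x n ≠ y n}.Infinite}ᶜ := by
      rw [Filter.limsup_eq_iInf_iSup_of_nat', MeasurableSpace.measurableSet_iInf]
      intro m
      rw [hEq m]
      refine MeasurableSet.iUnion fun n => ?_
      have hmeas : Measurable[⨆ i : ℕ, MeasurableSpace.comap (fun x : ℕ → Bool => x (i + m))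
          inferInstance] (tail (n + m)) := by
        refine @measurable_pi_lambda _ _ _ (_) _ _ fun i => ?_
        rw [measurable_iff_comap_le]
        refine le_trans (le_of_eq ?_) (le_iSup _ (i + n))
        simp only [tail, add_assoc]
      exact hmeas (hcl _).measurableSet
    have h01 := ProbabilityTheory.measure_zero_or_one_of_measurableSet_limsup_atTop
      (fun i => (measurable_pi_apply i).comap_le) hind htail
    have hsub : F ⊆ {x : ℕ → Bool | ∀ y ∈ F, {n : ℕ | x n ≠ y n}.Infinite}ᶜ := by
      intro y hy h
      have := h y hy
      simp at this
    have hone := h01.resolve_left (fun h => (hpos.trans_le (measure_mono hsub)).ne' h)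
    have hm : MeasurableSet {x : ℕ → Bool | ∀ y ∈ F, {n : ℕ | x n ≠ y n}.Infinite}ᶜ := by
      rw [hEq 0]
      exact MeasurableSet.iUnion fun n => ((hcl _).preimage (htc _)).measurableSet
    have := (prob_compl_eq_zero_iff hm).2 hone
    rwa [compl_compl] at this
end
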